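/- arXiv:2209.13501 — 2 statements merged into one kernel-verified Lean document; each statement's English description precedes it below -/
import Mathlib

section
/- Let r = X → Y be a totally-ordered sequential rule over a sequence database D, and let r' be a ToSR obtained from r by a right I-expansion or a right S-expansion with an item i. Then u(r') ≤ RERSU(r'), where RERSU(r') = Σ_{s ∈ seq(r')} REPEU(r, s). -/
open scoped Classical

noncomputable section

namespace TotalSR

variable {I : Type*} [LinearOrder I]

/-- A sequence: a list of itemsets. -/
abbrev Seqc (I : Type*) := List (Finset I)

/-- The set of items occurring in a sequence. -/
def itemsOf (s : Seqc I) : Finset I := s.foldr (· ∪ ·) ∅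

/-- Well-formed sequence: nonempty, all itemsets nonempty, and each item
occurs at most once (itemsets pairwise disjoint). -/
def WFSeq (s : Seqc I) : Prop :=
  s ≠ [] ∧ (∀ e ∈ s, e.Nonempty) ∧ s.Pairwise fun a b => Disjoint a b

/-- `s₁` occurs in `s₂` (written s₁ ⊑ s₂): there exist strictly increasing
indices matching each itemset of `s₁` into a superset itemset of `s₂`. -/
def OccursIn (s₁ s₂ : Seqc I) : Prop :=
  ∃ t : List (Finset I), t.Sublist s₂ ∧ List.Forall₂ (· ⊆ ·) s₁ t

/-- The rule X → Y occurs in s: there is a split position 1 ≤ k < |s|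
with X occurring in the first k itemsets and Y in the remaining ones. -/
def RuleOccursIn (X Y s : Seqc I) : Prop :=
  ∃ k, 1 ≤ k ∧ k < s.length ∧ OccursIn X (s.take k) ∧ OccursIn Y (s.drop k)

/-- seq(r): the sequences of the database D in which the rule X → Y occurs. -/
def seqL (D : List (Seqc I)) (X Y : Seqc I) : List (Seqc I) :=
  D.filter fun s => decide (RuleOccursIn X Y s)

/-- ant(r): the sequences of the database D in which the antecedent X occurs. -/
def antL (D : List (Seqc I)) (X : Seqc I) : List (Seqc I) :=
  D.filter fun s => decide (OccursIn X s)

/-- conf(r) = |seq(r)| / |ant(r)|. -/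
def conf (D : List (Seqc I)) (X Y : Seqc I) : ℝ :=
  ((seqL D X Y).length : ℝ) / ((antL D X).length : ℝ)

variable (q : I → Seqc I → ℝ) (iu : I → ℝ)

/-- u(i, s) = q(i, s) · iu(i). -/
def itemUtil (j : I) (s : Seqc I) : ℝ := q j s * iu j

/-- u(r, s): the sum of u(i, s) over all items occurring in X or Y. -/
def ruleUtilIn (X Y s : Seqc I) : ℝ :=
  ∑ j ∈ itemsOf X ∪ itemsOf Y, itemUtil q iu j s

/-- u(r) = Σ_{s ∈ seq(r)} u(r, s). -/
def ruleUtil (D : List (Seqc I)) (X Y : Seqc I) : ℝ :=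
  ((seqL D X Y).map (ruleUtilIn q iu X Y)).sum

/-- I-extension of a sequence: insert item i into the last itemset. -/
def iExt (X : Seqc I) (i : I) : Seqc I := X.dropLast ++ [insert i (X.getLastD ∅)]

/-- S-extension of a sequence: append the singleton itemset {i}. -/
def sExt (X : Seqc I) (i : I) : Seqc I := X ++ [{i}]

/-- X' is obtained from the rule X → Y by a left I- or S-expansion with item i. -/
def IsLeftExp (X Y : Seqc I) (i : I) (X' : Seqc I) : Prop :=
  i ∉ itemsOf Y ∧
    ((X' = iExt X i ∧ ∀ a ∈ X.getLastD ∅, a < i) ∨ X' = sExt X i)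

/-- Y' is obtained from the rule X → Y by a right I- or S-expansion with item i. -/
def IsRightExp (X Y : Seqc I) (i : I) (Y' : Seqc I) : Prop :=
  i ∉ itemsOf X ∧
    ((Y' = iExt Y i ∧ ∀ a ∈ Y.getLastD ∅, a < i) ∨ Y' = sExt Y i)

/-- ULeft(r, s): sum of u(j, s) over items j of s such that some left
expansion of r with j occurs in s. -/
def ULeft (X Y s : Seqc I) : ℝ :=
  ∑ j ∈ (itemsOf s).filter
      (fun j => ∃ X', IsLeftExp X Y j X' ∧ RuleOccursIn X' Y s),
    itemUtil q iu j s

/-- LEPEU(r, s). -/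
def LEPEUs (X Y s : Seqc I) : ℝ :=
  if 0 < ULeft q iu X Y s then ruleUtilIn q iu X Y s + ULeft q iu X Y s else 0

/-- LEPEU(r) = Σ_{s ∈ seq(r)} LEPEU(r, s). -/
def LEPEU (D : List (Seqc I)) (X Y : Seqc I) : ℝ :=
  ((seqL D X Y).map (LEPEUs q iu X Y)).sum

/-- URight(r, s): sum of u(j, s) over items j of s such that some right
expansion of r with j occurs in s. -/
def URight (X Y s : Seqc I) : ℝ :=
  ∑ j ∈ (itemsOf s).filter
      (fun j => ∃ Y', IsRightExp X Y j Y' ∧ RuleOccursIn X Y' s),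
    itemUtil q iu j s

/-- REPEU(r, s). -/
def REPEUs (X Y s : Seqc I) : ℝ :=
  if 0 < URight q iu X Y s then ruleUtilIn q iu X Y s + URight q iu X Y s else 0

/-- REPEU(r) = Σ_{s ∈ seq(r)} REPEU(r, s). -/
def REPEU (D : List (Seqc I)) (X Y : Seqc I) : ℝ :=
  ((seqL D X Y).map (REPEUs q iu X Y)).sum

/-- j occurs strictly after i in s: in a strictly later itemset, or in the
same itemset and strictly greater in the item order. -/
def AfterIn (s : Seqc I) (i j : I) : Prop :=
  ∃ a b : Fin s.length, i ∈ s.get a ∧ j ∈ s.get b ∧ (a < b ∨ (a = b ∧ i < j))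

/-- UILeft(r, i, s): u(i, s) plus the sum of u(j, s) over items j of s
occurring strictly after i such that some left expansion of r with j occurs in s. -/
def UILeft (X Y : Seqc I) (i : I) (s : Seqc I) : ℝ :=
  itemUtil q iu i s +
    ∑ j ∈ (itemsOf s).filter
        (fun j => AfterIn s i j ∧ ∃ X', IsLeftExp X Y j X' ∧ RuleOccursIn X' Y s),
      itemUtil q iu j s

/-- LERSPEU(r') = Σ_{s ∈ seq(r')} (u(r, s) + UILeft(r, i, s)), where r' = X⋄i → Y. -/
def LERSPEU (D : List (Seqc I)) (X Y : Seqc I) (i : I) (X' : Seqc I) : ℝ :=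
  ((seqL D X' Y).map fun s => ruleUtilIn q iu X Y s + UILeft q iu X Y i s).sum

/-- UIRight(r, i, s): u(i, s) plus the sum of u(j, s) over items j of s
occurring strictly after i in s. -/
def UIRight (i : I) (s : Seqc I) : ℝ :=
  itemUtil q iu i s +
    ∑ j ∈ (itemsOf s).filter (fun j => AfterIn s i j), itemUtil q iu j s

/-- RERSPEU(r') = Σ_{s ∈ seq(r')} (u(r, s) + UIRight(r, i, s)), where r' = X → Y⋄i. -/
def RERSPEU (D : List (Seqc I)) (X Y : Seqc I) (i : I) (Y' : Seqc I) : ℝ :=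
  ((seqL D X Y').map fun s => ruleUtilIn q iu X Y s + UIRight q iu i s).sum

/-- The total utility of all items occurring in a sequence. -/
def totalUtil (s : Seqc I) : ℝ := ∑ j ∈ itemsOf s, itemUtil q iu j s

/-- SEU(i): sum, over the sequences of D in which item i occurs, of the
total utility of the sequence. -/
def SEUitem (D : List (Seqc I)) (i : I) : ℝ :=
  ((D.filter fun s => decide (i ∈ itemsOf s)).map (totalUtil q iu)).sum

/-- SEU(r): sum, over the sequences of D in which the rule r occurs, of the
total utility of the sequence. -/
def SEUrule (D : List (Seqc I)) (X Y : Seqc I) : ℝ :=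
  ((seqL D X Y).map (totalUtil q iu)).sum

/-- One expansion step on rules (as pairs (antecedent, consequent)):
either a left I- or S-expansion or a right I- or S-expansion with some item. -/
def ExpStep (p p' : Seqc I × Seqc I) : Prop :=
  (∃ i, IsLeftExp p.1 p.2 i p'.1 ∧ p'.2 = p.2) ∨
    (∃ i, IsRightExp p.1 p.2 i p'.2 ∧ p'.1 = p.1)

theorem mem_itemsOf {s : Seqc I} {j : I} : j ∈ itemsOf s ↔ ∃ e ∈ s, j ∈ e := by
  induction s with
  | nil => simp [itemsOf]
  | cons a s ih =>
    have h : itemsOf (a :: s) = a ∪ itemsOf s := rfl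
    simp [h, ih]

theorem itemsOf_append (s t : Seqc I) : itemsOf (s ++ t) = itemsOf s ∪ itemsOf t := by
  ext j
  simp only [Finset.mem_union, mem_itemsOf, List.mem_append, or_and_right, exists_or]

theorem itemsOf_singleton (e : Finset I) : itemsOf [e] = e := by
  ext j
  simp [mem_itemsOf]

theorem itemsOf_sExt (s : Seqc I) (i : I) : itemsOf (sExt s i) = insert i (itemsOf s) := by
  rw [sExt, itemsOf_append, itemsOf_singleton, Finset.union_comm, Finset.insert_eq]

theorem itemsOf_iExt (s : Seqc I) (i : I) : itemsOf (iExt s i) = insert i (itemsOf s) := by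
  rcases List.eq_nil_or_concat s with rfl | ⟨t, e, rfl⟩
  · simp [iExt, itemsOf]
  · simp [iExt, itemsOf_append, itemsOf_singleton]

theorem IsRightExp.itemsOf_eq {X Y Y' : Seqc I} {i : I} (h : IsRightExp X Y i Y') :
    itemsOf Y' = insert i (itemsOf Y) := by
  rcases h.2 with ⟨rfl, -⟩ | rfl
  · exact itemsOf_iExt Y i
  · exact itemsOf_sExt Y i

theorem OccursIn.itemsOf_subset {s t : Seqc I} (h : OccursIn s t) :
    itemsOf s ⊆ itemsOf t := by
  obtain ⟨l, hl, hf⟩ := h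
  have hsl : itemsOf s ⊆ itemsOf l := by
    clear hl
    induction hf with
    | nil => exact subset_rfl
    | cons hab _ ih => exact Finset.union_subset_union hab ih
  intro j hj
  obtain ⟨e, he, hje⟩ := mem_itemsOf.1 (hsl hj)
  exact mem_itemsOf.2 ⟨e, hl.subset he, hje⟩

theorem RuleOccursIn.itemsOf_right_subset {X Y s : Seqc I} (h : RuleOccursIn X Y s) :
    itemsOf Y ⊆ itemsOf s := by
  obtain ⟨k, -, -, -, hY⟩ := h
  intro j hj
  obtain ⟨e, he, hje⟩ := mem_itemsOf.1 (hY.itemsOf_subset hj)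
  exact mem_itemsOf.2 ⟨e, List.mem_of_mem_drop he, hje⟩

/-- In a sequence where the expanded rule occurs, its utility is bounded by the REPEU of the
original rule. -/
theorem IsRightExp.ruleUtilIn_le_REPEUs {X Y Y' s : Seqc I} {i : I}
    (hpos : ∀ j ∈ itemsOf s, 0 < itemUtil q iu j s)
    (hexp : IsRightExp X Y i Y') (hocc : RuleOccursIn X Y' s) :
    ruleUtilIn q iu X Y' s ≤ REPEUs q iu X Y s := by
  have hi : i ∈ itemsOf s :=
    hocc.itemsOf_right_subset (hexp.itemsOf_eq ▸ Finset.mem_insert_self i _)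
  have hui := hpos i hi
  have hright : itemUtil q iu i s ≤ URight q iu X Y s :=
    Finset.single_le_sum (f := fun j => itemUtil q iu j s)
      (fun j hj => (hpos j (Finset.mem_filter.1 hj).1).le)
      (Finset.mem_filter.2 ⟨hi, Y', hexp, hocc⟩)
  have hrule : ruleUtilIn q iu X Y' s ≤ ruleUtilIn q iu X Y s + itemUtil q iu i s := by
    rw [ruleUtilIn, hexp.itemsOf_eq, Finset.union_insert, ruleUtilIn]
    by_cases hmem : i ∈ itemsOf X ∪ itemsOf Y
    · rw [Finset.insert_eq_of_mem hmem]
      linarith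
    · rw [Finset.sum_insert hmem, add_comm]
  rw [REPEUs, if_pos (hui.trans_le hright)]
  linarith

/-- if r' is obtained from r = X → Y by a right I- or S-expansion
with item i, then u(r') ≤ RERSU(r') = Σ_{s ∈ seq(r')} REPEU(r, s). -/
theorem utility_le_RERSU_of_rightExp
    (hiu : ∀ j : I, 0 < iu j)
    (hq : ∀ (j : I) (s : Seqc I), j ∈ itemsOf s → 0 < q j s)
    (D : List (Seqc I)) (hD : ∀ s ∈ D, WFSeq s)
    (X Y : Seqc I) (hX : WFSeq X) (hY : WFSeq Y)
    (hXY : Disjoint (itemsOf X) (itemsOf Y))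
    (i : I) (Y' : Seqc I) (hexp : IsRightExp X Y i Y')
    (hY' : WFSeq Y') (hXY' : Disjoint (itemsOf X) (itemsOf Y')) :
    ruleUtil q iu D X Y' ≤ ((seqL D X Y').map (REPEUs q iu X Y)).sum := by
  refine List.sum_le_sum fun s hs => hexp.ruleUtilIn_le_REPEUs q iu ?_ ?_
  · exact fun j hj => mul_pos (hq j s hj) (hiu j)
  · exact of_decide_eq_true (List.mem_filter.1 hs).2

end TotalSR
end
end

section
/- Let r be a totally-ordered sequential rule over a sequence database D, and let r' be a ToSR obtained from r by a single left or right I- or S-expansion with an item i. Then every sequence in which r' occurs is also a sequence in which r occurs; in particular, seq(r') ⊆ seq(r) and |seq(r')| ≤ |seq(r)| (the support of ToSRs is anti-monotonic under expansion). -/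
open scoped Classical

noncomputable section

namespace TotalSR

variable {I : Type*} [LinearOrder I]

variable (q : I → Seqc I → ℝ) (iu : I → ℝ)

theorem occursIn_iff_sublistForall₂ {s₁ s₂ : Seqc I} :
    OccursIn s₁ s₂ ↔ List.SublistForall₂ (· ⊆ ·) s₁ s₂ := by
  simp only [OccursIn, List.sublistForall₂_iff, and_comm]

theorem OccursIn.trans {s₁ s₂ s₃ : Seqc I} (h₁ : OccursIn s₁ s₂) (h₂ : OccursIn s₂ s₃) :
    OccursIn s₁ s₃ := by
  rw [occursIn_iff_sublistForall₂] at *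
  exact _root_.trans h₁ h₂

theorem occursIn_sExt (X : Seqc I) (i : I) : OccursIn X (sExt X i) :=
  ⟨X, List.sublist_append_left X [{i}], List.forall₂_refl X⟩

theorem occursIn_iExt (X : Seqc I) (hX : X ≠ []) (i : I) : OccursIn X (iExt X i) := by
  refine ⟨iExt X i, List.Sublist.refl _, ?_⟩
  conv_lhs => rw [← List.dropLast_append_getLast hX]
  refine List.rel_append (List.forall₂_refl _) (List.Forall₂.cons ?_ List.Forall₂.nil)
  rw [List.getLastD_eq_getLast?, List.getLast?_eq_some_getLast hX]
  exact Finset.subset_insert _ _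

theorem IsLeftExp.occursIn {X Y X' : Seqc I} {i : I} (hX : X ≠ []) (h : IsLeftExp X Y i X') :
    OccursIn X X' := by
  obtain ⟨-, ⟨rfl, -⟩ | rfl⟩ := h
  exacts [occursIn_iExt X hX i, occursIn_sExt X i]

theorem IsRightExp.occursIn {X Y Y' : Seqc I} {i : I} (hY : Y ≠ []) (h : IsRightExp X Y i Y') :
    OccursIn Y Y' :=
  IsLeftExp.occursIn hY h

theorem RuleOccursIn.mono {X X' Y Y' s : Seqc I} (hX : OccursIn X X') (hY : OccursIn Y Y')
    (h : RuleOccursIn X' Y' s) : RuleOccursIn X Y s := by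
  obtain ⟨k, hk, hks, hXs, hYs⟩ := h
  exact ⟨k, hk, hks, hX.trans hXs, hY.trans hYs⟩

theorem seqL_sublist {X X' Y Y' : Seqc I} (hX : OccursIn X X') (hY : OccursIn Y Y')
    (D : List (Seqc I)) : (seqL D X' Y').Sublist (seqL D X Y) :=
  List.monotone_filter_right D fun _ hs =>
    decide_eq_true (RuleOccursIn.mono hX hY (of_decide_eq_true hs))

/-- for a single left or right I- or S-expansion r' of r with an
item i, every sequence in which r' occurs is also one in which r occurs; in
particular seq(r') ⊆ seq(r) and |seq(r')| ≤ |seq(r)|. -/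
theorem support_antimonotone_of_expansion
    (hiu : ∀ j : I, 0 < iu j)
    (hq : ∀ (j : I) (s : Seqc I), j ∈ itemsOf s → 0 < q j s)
    (D : List (Seqc I)) (hD : ∀ s ∈ D, WFSeq s)
    (X Y X' Y' : Seqc I) (hX : WFSeq X) (hY : WFSeq Y)
    (hXY : Disjoint (itemsOf X) (itemsOf Y))
    (hX' : WFSeq X') (hY' : WFSeq Y')
    (hX'Y' : Disjoint (itemsOf X') (itemsOf Y'))
    (i : I)
    (hexp : (IsLeftExp X Y i X' ∧ Y' = Y) ∨ (IsRightExp X Y i Y' ∧ X' = X)) :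
    (∀ s : Seqc I, WFSeq s → RuleOccursIn X' Y' s → RuleOccursIn X Y s) ∧
    (∀ s ∈ seqL D X' Y', s ∈ seqL D X Y) ∧
    (seqL D X' Y').length ≤ (seqL D X Y).length := by
  have occursIn_self (Z : Seqc I) : OccursIn Z Z :=
    ⟨Z, List.Sublist.refl Z, List.forall₂_refl Z⟩
  have ⟨hXX', hYY'⟩ : OccursIn X X' ∧ OccursIn Y Y' := by
    obtain ⟨h, rfl⟩ | ⟨h, rfl⟩ := hexp
    · exact ⟨h.occursIn hX.1, occursIn_self _⟩
    · exact ⟨occursIn_self _, h.occursIn hY.1⟩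
  have hsub := seqL_sublist hXX' hYY' D
  exact ⟨fun _ _ => RuleOccursIn.mono hXX' hYY', fun _ hs => hsub.subset hs, hsub.length_le⟩

end TotalSR
end
end
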